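/- Let P ∈ D_n be a Dyck path and write F_P = {I_1, ..., I_m} with the intervals listed in increasing order of their minima. Then the number of occurrences of the consecutive factor duu in P (that is, indices i with w_i = d, w_{i+1} = u and w_{i+2} = u) equals |{ i ∈ {2,...,m} : I_{i−1} and I_i are distanced, or |I_i ∖ I_{i−1}| > 1 }| + δ, where δ = 1 if m ≥ 1 and min I_1 > 1, and δ = 0 otherwise. -/

import Mathlib

/-- A Dyck path of semilength `n`, encoded by its height function:
`h t` is the height after the first `t` steps (number of `u`'s minus number of `d`'s
among the first `t` letters). -/
structure DyckPath (n : ℕ) where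
  h : ℕ → ℤ
  init : h 0 = 0
  tail : ∀ t, 2 * n ≤ t → h t = 0
  step : ∀ t, t < 2 * n → h (t + 1) = h t + 1 ∨ h (t + 1) = h t - 1
  nonneg : ∀ t, 0 ≤ h t

/-- The partial order on Dyck paths: `P ≤ Q` iff the height of `P` is pointwise
at most the height of `Q`. -/
def dle {n : ℕ} (P Q : DyckPath n) : Prop := ∀ t, P.h t ≤ Q.h t

/-- `R` is the relative pseudocomplement `P ⇝ Q` in the Dyck algebra `𝔇_n`:
`R` is the greatest Dyck path such that `P ∧ R ≤ Q` (meet being the pointwise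
minimum of height functions). -/
def IsRelPseudo {n : ℕ} (P Q R : DyckPath n) : Prop :=
  (∀ t, min (P.h t) (R.h t) ≤ Q.h t) ∧
  ∀ S : DyckPath n, (∀ t, min (P.h t) (S.h t) ≤ Q.h t) → dle S R

/-- The height function of the minimum Dyck path `(ud)^n`. -/
def minH (n : ℕ) (t : ℕ) : ℤ := if 2 * n ≤ t then 0 else (t : ℤ) % 2

/-- The minimum Dyck path `(ud)^n` of semilength `n`. -/
def minPath (n : ℕ) : DyckPath n where
  h := minH n
  init := by unfold minH; split_ifs <;> omega
  tail := by intro t ht; unfold minH; split_ifs <;> omega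
  step := by intro t ht; unfold minH; split_ifs <;> omega
  nonneg := by intro t; unfold minH; split_ifs <;> omega

/-- `R` is the pseudocomplement `∼P = P ⇝ 0` in the Dyck algebra `𝔇_n`. -/
def IsPseudo {n : ℕ} (P R : DyckPath n) : Prop := IsRelPseudo P (minPath n) R

/-- `x` is a return of `P`: an even abscissa `2 ≤ x ≤ 2n` where the path touches the `x`-axis. -/
def IsReturn {n : ℕ} (P : DyckPath n) (x : ℕ) : Prop :=
  Even x ∧ 2 ≤ x ∧ x ≤ 2 * n ∧ P.h x = 0

/-- Every factor of `P` (portion between two consecutive points of the path on the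
`x`-axis) is a pyramid `u^k d^k`, i.e. between two consecutive zeroes `a < b` of the
height function the height is `min (t - a) (b - t)`. -/
def FactorsArePyramids {n : ℕ} (P : DyckPath n) : Prop :=
  ∀ a b : ℕ, a < b → b ≤ 2 * n → P.h a = 0 → P.h b = 0 →
    (∀ c, a < c → c < b → 0 < P.h c) →
    ∀ t, a ≤ t → t ≤ b → P.h t = min ((t : ℤ) - (a : ℤ)) ((b : ℤ) - (t : ℤ))

/-- The height function of the join-irreducible Dyck path `J_{[a,b]}` of semilength `n`
(`1 ≤ a ≤ b ≤ n−1`): all factors are hills except a single pyramid `u^{b−a+2} d^{b−a+2}`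
occupying abscissas `2a−2` through `2b+2`. -/
def heightJ (a b t : ℕ) : ℤ :=
  if 2 * (a : ℤ) - 2 ≤ (t : ℤ) ∧ (t : ℤ) ≤ 2 * (b : ℤ) + 2 then
    min ((t : ℤ) - (2 * (a : ℤ) - 2)) (2 * (b : ℤ) + 2 - (t : ℤ))
  else (t : ℤ) % 2

/-- `J_{[a,b]} ≤ P` in the Dyck lattice: the height of the join-irreducible `J_{[a,b]}`
is pointwise below the height of `P`. -/
def JIle {n : ℕ} (P : DyckPath n) (a b : ℕ) : Prop :=
  ∀ t, t ≤ 2 * n → heightJ a b t ≤ P.h t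

/-- `[a,b]` is an interval of `[n−1] = {1, …, n−1}`. -/
def validIvl (n a b : ℕ) : Prop := 1 ≤ a ∧ a ≤ b ∧ b ≤ n - 1

/-- `F_P`: the antichain of all inclusion-maximal intervals `[a,b] ⊆ [n−1]`
with `J_{[a,b]} ≤ P` (intervals encoded as pairs `(a,b)`). -/
def FP {n : ℕ} (P : DyckPath n) : Set (ℕ × ℕ) :=
  {p | validIvl n p.1 p.2 ∧ JIle P p.1 p.2 ∧
    ∀ q : ℕ × ℕ, validIvl n q.1 q.2 → JIle P q.1 q.2 →
      Set.Icc p.1 p.2 ⊆ Set.Icc q.1 q.2 → q = p}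

/-- `‖F_P‖ = |⋃_{I ∈ F_P} I|`. -/
noncomputable def normFP {n : ℕ} (P : DyckPath n) : ℕ :=
  (⋃ p ∈ FP P, Set.Icc p.1 p.2).ncard

/-- `F_P*`: the set of internal intervals of `F_P`, those containing neither `1` nor `n−1`. -/
def FPstar {n : ℕ} (P : DyckPath n) : Set (ℕ × ℕ) :=
  {p ∈ FP P | 1 ∉ Set.Icc p.1 p.2 ∧ n - 1 ∉ Set.Icc p.1 p.2}

/-- `P` has a peak with apex at abscissa `t`: the `t`-th letter of `P` is `u` and the
`(t+1)`-st is `d`. -/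
def IsPeak {n : ℕ} (P : DyckPath n) (t : ℕ) : Prop :=
  1 ≤ t ∧ t + 1 ≤ 2 * n ∧ P.h t = P.h (t - 1) + 1 ∧ P.h (t + 1) = P.h t - 1

/-- `P` has a hill (peak at height 1, i.e. lying on the `x`-axis) with apex at abscissa `t`. -/
def IsHill {n : ℕ} (P : DyckPath n) (t : ℕ) : Prop :=
  IsPeak P t ∧ P.h (t - 1) = 0

/-- Two consecutive intervals `p = I_{i−1}` and `q = I_i` are distanced when
`max I_{i−1} < min I_i − 1`. -/
def Distanced (p q : ℕ × ℕ) : Prop := p.2 < q.1 - 1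

/-- An occurrence of the consecutive factor `duu` in `P` at (1-indexed) letter
position `i`: the `i`-th letter is `d` and the `(i+1)`-st and `(i+2)`-nd are `u`. -/
def IsDuu {n : ℕ} (P : DyckPath n) (i : ℕ) : Prop :=
  1 ≤ i ∧ i + 2 ≤ 2 * n ∧ P.h i = P.h (i - 1) - 1 ∧
  P.h (i + 1) = P.h i + 1 ∧ P.h (i + 2) = P.h (i + 1) + 1

namespace DyckPath

variable {n : ℕ} (P : DyckPath n)

theorem antitone_h_sub : Antitone fun t : ℕ => P.h t - t := by
  refine antitone_nat_of_succ_le fun t => ?_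
  push_cast
  rcases lt_or_ge t (2 * n) with ht | ht
  · rcases P.step t ht with h | h <;> omega
  · have h₁ := P.tail t ht
    have h₂ := P.tail (t + 1) (by omega)
    omega

theorem monotone_h_add : Monotone fun t : ℕ => P.h t + t := by
  refine monotone_nat_of_le_succ fun t => ?_
  push_cast
  rcases lt_or_ge t (2 * n) with ht | ht
  · rcases P.step t ht with h | h <;> omega
  · have h₁ := P.tail t ht
    have h₂ := P.tail (t + 1) (by omega)
    omega

variable {P}

theorem h_sub_le {s t : ℕ} (hst : s ≤ t) : P.h t - t ≤ P.h s - s :=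
  P.antitone_h_sub hst

theorem h_add_le {s t : ℕ} (hst : s ≤ t) : P.h s + s ≤ P.h t + t :=
  P.monotone_h_add hst

theorem lt_of_h_sub_lt {s t : ℕ} (h : P.h t - t < P.h s - s) : s < t :=
  P.antitone_h_sub.reflect_lt h

theorem h_emod_two (t : ℕ) (ht : t ≤ 2 * n) : P.h t % 2 = t % 2 := by
  induction t with
  | zero => simp [P.init]
  | succ t ih =>
    have := ih (by omega)
    rcases P.step t (by omega) with h | h <;> omega

theorem lt_two_mul_of_h_succ_ne {t : ℕ} (h : P.h (t + 1) ≠ P.h t) : t < 2 * n := by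
  by_contra! ht
  exact h (by rw [P.tail t ht, P.tail (t + 1) (by omega)])

/-- The up run starting at `s` ends in a peak. -/
theorem exists_isPeak_of_up {s : ℕ} (hs : P.h (s + 1) = P.h s + 1) :
    ∃ t, s < t ∧ IsPeak P t ∧ P.h t - t = P.h s - s := by
  have hs2 : s < 2 * n := lt_two_mul_of_h_succ_ne (P := P) (by omega)
  set t := Nat.findGreatest (fun t : ℕ => P.h t - t = P.h s - s) (2 * n)
  have hle : t ≤ 2 * n := Nat.findGreatest_le _
  have hst : s + 1 ≤ t := Nat.le_findGreatest (by omega) (by rw [hs]; push_cast; ring)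
  have hg : P.h t - t = P.h s - s :=
    Nat.findGreatest_spec (P := fun t : ℕ => P.h t - t = P.h s - s) hs2.le rfl
  have hs0 := P.nonneg s
  have htlt : t < 2 * n := by
    by_contra! h
    have := P.tail t h
    omega
  have hnext : ¬ (P.h (t + 1) - (t + 1 : ℕ) = P.h s - s) :=
    Nat.findGreatest_is_greatest (P := fun t : ℕ => P.h t - t = P.h s - s)
      (Nat.lt_succ_self t) htlt
  have h₁ := h_sub_le (P := P) (show s ≤ t - 1 by omega)
  have h₂ := h_sub_le (P := P) (show t - 1 ≤ t by omega)
  refine ⟨t, hst, ⟨by omega, htlt, by omega, ?_⟩, hg⟩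
  rcases P.step t htlt with h | h <;> omega

/-- The down run ending at `s + 1` starts from a peak. -/
theorem exists_isPeak_of_down {s : ℕ} (hs : P.h (s + 1) = P.h s - 1) :
    ∃ t, t ≤ s ∧ IsPeak P t ∧ P.h t + t = P.h s + s := by
  have hs2 : s < 2 * n := lt_two_mul_of_h_succ_ne (P := P) (by omega)
  have hex : ∃ t : ℕ, P.h t + t = P.h s + s := ⟨s, rfl⟩
  set t := Nat.find hex
  have hts : t ≤ s := Nat.find_min' hex rfl
  have hf : P.h t + t = P.h s + s := Nat.find_spec hex
  have h₀ := P.nonneg (s + 1)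
  have ht0 : t ≠ 0 := by
    intro h
    rw [h, P.init] at hf
    push_cast at hf
    omega
  have hprev := Nat.find_min hex (m := t - 1) (by omega)
  have h₁ := h_add_le (P := P) (show t ≤ t + 1 by omega)
  have h₂ := h_add_le (P := P) (show t + 1 ≤ s + 1 by omega)
  refine ⟨t, hts, ⟨by omega, by omega, ?_, by push_cast at *; omega⟩, hf⟩
  have h₃ := P.step (t - 1) (by omega)
  rw [show t - 1 + 1 = t by omega] at h₃
  rcases h₃ with h | h <;> omega

theorem jIle_iff {a b : ℕ} (hv : validIvl n a b) :
    JIle P a b ↔ (b : ℤ) - a + 2 ≤ P.h (a + b) := by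
  obtain ⟨ha, hab, hb⟩ := hv
  constructor
  · intro h
    have := h (a + b) (by omega)
    unfold heightJ at this
    rw [if_pos (by omega)] at this
    push_cast at this
    omega
  · intro h t ht
    have h₀ := P.nonneg t
    have h₁ := h_emod_two (P := P) t ht
    unfold heightJ
    split_ifs
    · rcases le_total t (a + b) with hle | hle
      · have := h_sub_le (P := P) hle
        push_cast at this
        omega
      · have := h_add_le (P := P) hle
        push_cast at this
        omega
    · omega

theorem mem_FP_of_isPeak {a b : ℕ} (hab : a ≤ b) (ht : IsPeak P (a + b))
    (hh : P.h (a + b) = (b : ℤ) - a + 2) : (a, b) ∈ FP P := by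
  obtain ⟨h1, h2, hu, hd⟩ := ht
  have hl := h_sub_le (P := P) (Nat.zero_le (a + b))
  have hr := h_add_le (P := P) (show a + b ≤ 2 * n by omega)
  rw [P.init] at hl
  rw [P.tail _ le_rfl] at hr
  push_cast at hl hr
  have hv : validIvl n a b := ⟨by omega, hab, by omega⟩
  refine ⟨hv, (jIle_iff hv).2 (by omega), ?_⟩
  rintro ⟨c, d⟩ hv' hJ hsub
  rw [jIle_iff hv'] at hJ
  rw [Set.Icc_subset_Icc_iff hab] at hsub
  dsimp only at hJ hsub
  obtain ⟨hca, hbd⟩ := hsub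
  rcases lt_trichotomy (c + d) (a + b) with h | h | h
  · have := h_add_le (P := P) (show c + d ≤ a + b - 1 by omega)
    push_cast [Nat.cast_sub h1] at this
    omega
  · rw [h] at hJ
    ext <;> dsimp only <;> omega
  · have := h_sub_le (P := P) (show a + b + 1 ≤ c + d by omega)
    push_cast at this
    omega

theorem isPeak_of_mem_FP {p : ℕ × ℕ} (hp : p ∈ FP P) :
    IsPeak P (p.1 + p.2) ∧ P.h (p.1 + p.2) = (p.2 : ℤ) - p.1 + 2 := by
  obtain ⟨a, b⟩ := p
  obtain ⟨hv, hJ, hmax⟩ := hp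
  dsimp only at *
  rw [jIle_iff hv] at hJ
  have hgrow : ∀ c d : ℕ, 1 ≤ c → c ≤ a → b ≤ d → d ≤ n - 1 →
      (d : ℤ) - c + 2 ≤ P.h (c + d) → c = a ∧ d = b := by
    intro c d hc hca hbd hd hJ'
    have hv' : validIvl n c d := ⟨hc, by have := hv.2.1; omega, hd⟩
    have := hmax (c, d) hv' ((jIle_iff hv').2 hJ') (Set.Icc_subset_Icc hca hbd)
    simpa using this
  obtain ⟨ha, hab, hb⟩ := hv
  have hl := h_sub_le (P := P) (Nat.zero_le (a + b))
  have hr := h_add_le (P := P) (show a + b ≤ 2 * n by omega)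
  rw [P.init] at hl
  rw [P.tail _ le_rfl] at hr
  push_cast at hl hr
  have hpar := h_emod_two (P := P) (a + b) (by omega)
  push_cast at hpar
  have hh : P.h (a + b) = (b : ℤ) - a + 2 := by
    by_contra hne
    have h4 : (b : ℤ) - a + 4 ≤ P.h (a + b) := by omega
    have := hgrow (a - 1) (b + 1) (by omega) (by omega) (by omega) (by omega) (by
      rw [show a - 1 + (b + 1) = a + b by omega]
      push_cast [Nat.cast_sub ha]
      omega)
    omega
  refine ⟨⟨by omega, by omega, ?_, ?_⟩, hh⟩
  · have hs := P.step (a + b - 1) (by omega)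
    rw [show a + b - 1 + 1 = a + b by omega] at hs
    rcases hs with h | h
    · exact h
    · have h₀ := h_sub_le (P := P) (Nat.zero_le (a + b - 1))
      rw [P.init] at h₀
      push_cast [Nat.cast_sub (show 1 ≤ a + b by omega)] at h₀
      have := hgrow (a - 1) b (by omega) (by omega) le_rfl hb (by
        rw [show a - 1 + b = a + b - 1 by omega]
        push_cast [Nat.cast_sub ha]
        omega)
      omega
  · rcases P.step (a + b) (by omega) with h | h
    · have h₀ := h_add_le (P := P) (show a + b + 1 ≤ 2 * n by omega)
      rw [P.tail _ le_rfl] at h₀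
      push_cast at h₀
      have := hgrow a (b + 1) ha le_rfl (by omega) (by omega) (by
        rw [show a + (b + 1) = a + b + 1 by omega]
        push_cast
        omega)
      omega
    · exact h

theorem exists_mem_FP_of_isPeak {t : ℕ} (ht : IsPeak P t) (h2 : 2 ≤ P.h t) :
    ∃ p ∈ FP P, p.1 + p.2 = t ∧ P.h t - t = 2 - 2 * p.1 ∧ P.h t + t = 2 * p.2 + 2 := by
  have hle := ht.2.1
  have hpar := h_emod_two (P := P) t (by omega)
  have hl := h_sub_le (P := P) (Nat.zero_le t)
  rw [P.init] at hl
  push_cast at hl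
  obtain ⟨a, ha⟩ := Int.eq_ofNat_of_zero_le (show 0 ≤ (t - P.h t + 2) / 2 by omega)
  obtain ⟨b, hb⟩ := Int.eq_ofNat_of_zero_le (show 0 ≤ (t + P.h t - 2) / 2 by omega)
  have hab : a + b = t := by omega
  refine ⟨(a, b), mem_FP_of_isPeak (by omega) (by rwa [hab]) (by rw [hab]; omega), hab, ?_, ?_⟩ <;>
    dsimp only <;> omega

theorem FP_snd_le_snd {p q : ℕ × ℕ} (hp : p ∈ FP P) (hq : q ∈ FP P) (h : p.1 ≤ q.1) :
    p.2 ≤ q.2 := by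
  have hp' := (isPeak_of_mem_FP hp).2
  have hq' := (isPeak_of_mem_FP hq).2
  rcases h.eq_or_lt with h | h
  · by_contra! hlt
    have := hq.2.2 p hp.1 hp.2.1 (Set.Icc_subset_Icc h.le hlt.le)
    rw [this] at hlt
    omega
  · have hlt : p.1 + p.2 < q.1 + q.2 :=
      lt_of_h_sub_lt (P := P) (by push_cast; omega)
    have := h_add_le (P := P) hlt.le
    push_cast at this
    omega

/-- An occurrence of `duu` is determined by the value of `h t - t` along its up run. -/
theorem injOn_isDuu : Set.InjOn (fun i : ℕ => P.h i - i) {i | IsDuu P i} := by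
  have key : ∀ i j, IsDuu P j → i < j → P.h i - i ≠ P.h j - j := by
    intro i j hj hij
    obtain ⟨h1, -, hd, -⟩ := hj
    have := h_sub_le (P := P) (show i ≤ j - 1 by omega)
    omega
  intro i hi j hj hij
  rcases lt_trichotomy i j with h | h | h
  · exact (key i j hj h hij).elim
  · exact h
  · exact (key j i hi h hij.symm).elim

theorem _root_.IsDuu.exists_mem_FP {i : ℕ} (hi : IsDuu P i) :
    ∃ p ∈ FP P, P.h i - i = 2 - 2 * p.1 ∧ 1 < p.1 ∧ ∀ q ∈ FP P, q.1 < p.1 → q.2 + 2 ≤ p.2 := by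
  obtain ⟨h1, h2, hd, hu, huu⟩ := hi
  obtain ⟨t, hit, ht, hg⟩ := exists_isPeak_of_up hu
  have h₀ := P.nonneg i
  have hit2 : i + 2 ≤ t := by
    by_contra! h
    obtain rfl : t = i + 1 := by omega
    have := ht.2.2.2
    rw [show i + 1 + 1 = i + 2 by omega] at this
    omega
  obtain ⟨p, hp, hpt, hp1, hp2⟩ := exists_mem_FP_of_isPeak ht (by omega)
  have hl := h_sub_le (P := P) (Nat.zero_le (i - 1))
  rw [P.init] at hl
  push_cast [Nat.cast_sub h1] at hl
  refine ⟨p, hp, by omega, by omega, fun q hq hqp => ?_⟩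
  have hq' := (isPeak_of_mem_FP hq).2
  have hlt : q.1 + q.2 < i := lt_of_h_sub_lt (P := P) (by push_cast; omega)
  have := h_add_le (P := P) hlt.le
  push_cast at this
  omega

/-- The up run before a high peak, if it does not start the path and is not a `duu`, is a single
step, so that the preceding peak is high too. -/
theorem exists_isDuu_or_exists_mem_FP {p : ℕ × ℕ} (hp : p ∈ FP P) (h1 : 1 < p.1) :
    (∃ i, IsDuu P i ∧ P.h i - i = 2 - 2 * p.1) ∨
      ∃ q ∈ FP P, q.1 < p.1 ∧ p.2 = q.2 + 1 := by
  obtain ⟨⟨ht1, ht2, hu, hd⟩, hh⟩ := isPeak_of_mem_FP hp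
  have hle : p.1 ≤ p.2 := hp.1.2.1
  set t := p.1 + p.2 with ht
  have hex : ∃ i : ℕ, P.h i - i = P.h t - t := ⟨t, rfl⟩
  set i := Nat.find hex
  have hg : P.h i - i = P.h t - t := Nat.find_spec hex
  have hit : i ≤ t - 1 := Nat.find_min' hex (by push_cast [Nat.cast_sub ht1]; omega)
  have hi0 : i ≠ 0 := by
    intro h
    rw [h, P.init] at hg
    push_cast at hg
    omega
  have hprev := Nat.find_min hex (m := i - 1) (by omega)
  have hdown : P.h i = P.h (i - 1) - 1 := by
    have h₃ := P.step (i - 1) (by omega)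
    rw [show i - 1 + 1 = i by omega] at h₃
    rcases h₃ with h | h <;> omega
  have hrun : ∀ s, i ≤ s → s ≤ t → P.h s - s = P.h i - i := by
    intro s h h'
    have h₁ := h_sub_le (P := P) h
    have h₂ := h_sub_le (P := P) h'
    omega
  have hi1 := hrun (i + 1) (by omega) (by omega)
  rcases Nat.lt_or_ge (i + 1) t with hlt | hge
  · left
    have hi2 := hrun (i + 2) (by omega) (by omega)
    push_cast at hi1 hi2
    exact ⟨i, ⟨by omega, by omega, hdown, by omega, by omega⟩, by omega⟩
  · right
    obtain ⟨s, hs, hpk, hf⟩ := exists_isPeak_of_down (P := P) (s := i - 1)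
      (by rw [show i - 1 + 1 = i by omega]; exact hdown)
    obtain ⟨q, hq, -, hq1, hq2⟩ := exists_mem_FP_of_isPeak hpk (by omega)
    exact ⟨q, hq, by omega, by omega⟩

end DyckPath

theorem distanced_or_one_lt_ncard_iff {a b c d : ℕ} (hac : a < c) (hcd : c ≤ d) :
    (Distanced (a, b) (c, d) ∨ 1 < (Set.Icc c d \ Set.Icc a b).ncard) ↔ b + 2 ≤ d := by
  unfold Distanced
  dsimp only
  constructor
  · rintro (h | h)
    · omega
    · by_contra! hbd
      have hsub : Set.Icc c d \ Set.Icc a b ⊆ {d} := by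
        rintro x ⟨⟨h1, h2⟩, h3⟩
        simp only [Set.mem_Icc, not_and, not_le] at h3
        have := h3 (by omega)
        simp only [Set.mem_singleton_iff]
        omega
      have := Set.ncard_le_ncard hsub
      rw [Set.ncard_singleton] at this
      omega
  · intro h
    by_cases hd : b < c - 1
    · exact Or.inl hd
    · right
      rw [Set.one_lt_ncard (Set.toFinite _)]
      refine ⟨d, ⟨⟨hcd, le_rfl⟩, ?_⟩, d - 1, ⟨⟨by omega, by omega⟩, ?_⟩, by omega⟩ <;>
        simp only [Set.mem_Icc, not_and, not_le] <;> omega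

/-- Write `F_P = {I_1, …, I_m}` listed in increasing order of the minima of the
intervals. The number of occurrences of the consecutive factor `duu` in `P` equals
`|{ i ∈ {2,…,m} : I_{i−1}, I_i are distanced, or |I_i ∖ I_{i−1}| > 1 }| + δ`,
where `δ = 1` if `m ≥ 1` and `min I_1 > 1`, and `δ = 0` otherwise. -/
theorem num_duu_eq (n m : ℕ) (P : DyckPath n) (I : ℕ → ℕ × ℕ)
    (hmem : ∀ i, 1 ≤ i → i ≤ m → I i ∈ FP P)
    (hcover : ∀ p ∈ FP P, ∃ i, 1 ≤ i ∧ i ≤ m ∧ I i = p)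
    (hmono : ∀ i j, 1 ≤ i → i < j → j ≤ m → (I i).1 < (I j).1) :
    {i | IsDuu P i}.ncard =
      {i | 2 ≤ i ∧ i ≤ m ∧ (Distanced (I (i - 1)) (I i) ∨
          1 < (Set.Icc (I i).1 (I i).2 \ Set.Icc (I (i - 1)).1 (I (i - 1)).2).ncard)}.ncard
        + (if 1 ≤ m ∧ 1 < (I 1).1 then 1 else 0) := by
  have hinj : ∀ i j, 1 ≤ i → i ≤ m → 1 ≤ j → j ≤ m → (I i).1 = (I j).1 → i = j := by
    intro i j hi hi' hj hj' h
    rcases lt_trichotomy i j with hij | hij | hij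
    · exact absurd h (hmono i j hi hij hj').ne
    · exact hij
    · exact absurd h (hmono j i hj hij hi').ne'
  have hlt : ∀ i j, 1 ≤ i → i ≤ m → 1 ≤ j → j ≤ m → (I i).1 < (I j).1 → i < j := by
    intro i j hi hi' hj hj' h
    by_contra! hji
    rcases hji.eq_or_lt with hij | hij
    · subst hij; omega
    · exact absurd h (hmono j i hj hij hi').not_gt
  set S := {i | 2 ≤ i ∧ i ≤ m ∧ (Distanced (I (i - 1)) (I i) ∨
    1 < (Set.Icc (I i).1 (I i).2 \ Set.Icc (I (i - 1)).1 (I (i - 1)).2).ncard)}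
  have hSiff : ∀ k, k ∈ S ↔ 2 ≤ k ∧ k ≤ m ∧ (I (k - 1)).2 + 2 ≤ (I k).2 := by
    intro k
    refine and_congr_right fun hk => and_congr_right fun hk' => ?_
    exact distanced_or_one_lt_ncard_iff (hmono (k - 1) k (by omega) (by omega) hk')
      (hmem k (by omega) hk').1.2.1
  set T := {k | k = 1 ∧ 1 ≤ m ∧ 1 < (I 1).1} with hT
  have hSfin : S.Finite := (Set.finite_Iic m).subset fun k hk => hk.2.1
  have hTfin : T.Finite := (Set.finite_singleton 1).subset fun k hk => hk.1
  have hTcard : T.ncard = if 1 ≤ m ∧ 1 < (I 1).1 then 1 else 0 := by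
    split_ifs with h
    · rw [show T = {1} by ext k; simp [hT, h], Set.ncard_singleton]
    · rw [show T = ∅ by ext k; simp only [hT, Set.mem_ofPred_eq, h, and_false,
        Set.mem_empty_iff_false], Set.ncard_empty]
  have hdisj : Disjoint S T := Set.disjoint_left.2 fun k hk hk' => by
    have h1 := hk.1
    have h2 := hk'.1
    omega
  have himage : (fun i : ℕ => P.h i - i) '' {i | IsDuu P i} =
      (fun k : ℕ => (2 - 2 * (I k).1 : ℤ)) '' (S ∪ T) := by
    ext z
    constructor
    · rintro ⟨i, hi, rfl⟩
      obtain ⟨p, hp, hg, hp1, hmin⟩ := hi.exists_mem_FP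
      obtain ⟨k, hk, hkm, rfl⟩ := hcover p hp
      refine ⟨k, ?_, hg.symm⟩
      rcases hk.eq_or_lt with rfl | hk
      · exact Or.inr ⟨rfl, hkm, hp1⟩
      · exact Or.inl ((hSiff k).2 ⟨hk, hkm, hmin _ (hmem _ (by omega) (by omega))
          (hmono (k - 1) k (by omega) (by omega) hkm)⟩)
    · rintro ⟨k, hk, rfl⟩
      have hk1 : 1 ≤ k ∧ k ≤ m ∧ 1 < (I k).1 := by
        rcases hk with hk | ⟨rfl, hm, hk⟩
        · have := hmono (k - 1) k (by have := hk.1; omega) (by have := hk.1; omega) hk.2.1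
          have h1 := (hmem (k - 1) (by have := hk.1; omega) (by have := hk.2.1; omega)).1.1
          exact ⟨by have := hk.1; omega, hk.2.1, by omega⟩
        · exact ⟨le_rfl, hm, hk⟩
      obtain ⟨hk1, hkm, hak⟩ := hk1
      rcases DyckPath.exists_isDuu_or_exists_mem_FP (hmem k hk1 hkm) hak with
        ⟨i, hi, hg⟩ | ⟨q, hq, hqk, hq2⟩
      · exact ⟨i, hi, hg⟩
      · obtain ⟨j, hj, hjm, rfl⟩ := hcover q hq
        have hjk := hlt j k hj hjm hk1 hkm hqk
        rcases hk with hk | hk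
        · have hgap := ((hSiff k).1 hk).2.2
          have hle : (I j).1 ≤ (I (k - 1)).1 := by
            rcases (show j ≤ k - 1 by omega).eq_or_lt with h | h
            · rw [h]
            · exact (hmono j (k - 1) hj h (by omega)).le
          have := DyckPath.FP_snd_le_snd hq (hmem (k - 1) (by omega) (by omega)) hle
          omega
        · have := hk.1
          omega
  rw [← hTcard, ← Set.ncard_union_eq hdisj hSfin hTfin,
    ← DyckPath.injOn_isDuu.ncard_image, himage]
  refine Set.InjOn.ncard_image fun k hk l hl hkl => ?_
  have hmemST : ∀ k ∈ S ∪ T, 1 ≤ k ∧ k ≤ m := by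
    rintro k (hk | ⟨rfl, hm, -⟩)
    · exact ⟨by have := hk.1; omega, hk.2.1⟩
    · exact ⟨le_rfl, hm⟩
  exact hinj k l (hmemST k hk).1 (hmemST k hk).2 (hmemST l hl).1 (hmemST l hl).2
    (by simpa using hkl)
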